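/- If -1/2 < μ < 0, then there exists x₀ > 0 such that e_μ(x) < 0 for every x < -x₀. -/

import Mathlib

open MeasureTheory Real Set

/-- The generalized factorial γ_μ: γ_μ(2m) = 2^{2m} m! Γ(m+μ+1/2)/Γ(μ+1/2),
γ_μ(2m+1) = 2^{2m+1} m! Γ(m+μ+3/2)/Γ(μ+1/2). -/
noncomputable def genGamma (μ : ℝ) (n : ℕ) : ℝ :=
  if Even n then
    2 ^ n * (Nat.factorial (n / 2)) * Real.Gamma (((n / 2 : ℕ) : ℝ) + μ + 1 / 2) /
      Real.Gamma (μ + 1 / 2)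
  else
    2 ^ n * (Nat.factorial (n / 2)) * Real.Gamma (((n / 2 : ℕ) : ℝ) + μ + 3 / 2) /
      Real.Gamma (μ + 1 / 2)

/-- The generalized exponential function e_μ(x) = Σ_{m} x^m / γ_μ(m). -/
noncomputable def genExp (μ : ℝ) (x : ℝ) : ℝ := ∑' m : ℕ, x ^ m / genGamma μ m

/-- `genGamma μ (n + 1) = (n + 1 + 2 μ [n even]) * genGamma μ n`. -/
theorem genGamma_succ {μ : ℝ} (hμ : -1 / 2 < μ) (n : ℕ) :
    genGamma μ (n + 1) = genGamma μ n * (n + 1 + if Even n then 2 * μ else 0) := by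
  obtain ⟨k, rfl | rfl⟩ := n.even_or_odd'
  · have h1 : (2 * k + 1) / 2 = k := by omega
    have h2 : 2 * k / 2 = k := by omega
    have hk : (k : ℝ) + μ + 1 / 2 ≠ 0 := by
      have : (0 : ℝ) ≤ k := k.cast_nonneg
      linarith
    have hG : Real.Gamma ((k : ℝ) + μ + 3 / 2) =
        ((k : ℝ) + μ + 1 / 2) * Real.Gamma ((k : ℝ) + μ + 1 / 2) := by
      rw [← Real.Gamma_add_one hk]
      congr 1
      ring
    have ho : ¬ Even (2 * k + 1) := by simp
    have he : Even (2 * k) := even_two_mul k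
    simp only [genGamma, if_neg ho, if_pos he, h1, h2, hG]
    push_cast
    ring
  · have h1 : (2 * k + 1) / 2 = k := by omega
    have h2 : (2 * k + 1 + 1) / 2 = k + 1 := by omega
    have ho : ¬ Even (2 * k + 1) := by simp
    have he : Even (2 * k + 1 + 1) := ⟨k + 1, by ring⟩
    have hG : ((k + 1 : ℕ) : ℝ) + μ + 1 / 2 = (k : ℝ) + μ + 3 / 2 := by
      push_cast
      ring
    simp only [genGamma, if_neg ho, if_pos he, h1, h2, hG, Nat.factorial_succ]
    push_cast
    ring

theorem genGamma_zero {μ : ℝ} (hμ : -1 / 2 < μ) : genGamma μ 0 = 1 := by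
  have h : Real.Gamma (μ + 1 / 2) ≠ 0 := (Real.Gamma_pos_of_pos (by linarith)).ne'
  simp only [genGamma, Even.zero, if_true, Nat.zero_div, Nat.cast_zero, zero_add, pow_zero,
    Nat.factorial_zero, Nat.cast_one, one_mul]
  exact div_self h

theorem genGamma_one {μ : ℝ} (hμ : -1 / 2 < μ) : genGamma μ 1 = 1 + 2 * μ := by
  have h := genGamma_succ hμ 0
  simpa [genGamma_zero hμ] using h

theorem genGamma_pos {μ : ℝ} (hμ : -1 / 2 < μ) (n : ℕ) : 0 < genGamma μ n := by
  induction n with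
  | zero => simp [genGamma_zero hμ]
  | succ n ih =>
    rw [genGamma_succ hμ]
    have : (0 : ℝ) ≤ n := n.cast_nonneg
    refine mul_pos ih ?_
    split_ifs <;> linarith

theorem factorial_mul_le_genGamma_succ {μ : ℝ} (hμ : -1 / 2 < μ) (n : ℕ) :
    (1 + 2 * μ) * n.factorial ≤ genGamma μ (n + 1) := by
  induction n with
  | zero => simp [genGamma_one hμ]
  | succ n ih =>
    rw [genGamma_succ hμ (n + 1), Nat.factorial_succ]
    have hn : ((n + 1 : ℕ) : ℝ) ≤ (n + 1 : ℕ) + 1 + if Even (n + 1) then 2 * μ else 0 := by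
      split_ifs <;> linarith
    calc (1 + 2 * μ) * (((n + 1) * n.factorial : ℕ) : ℝ)
        = (1 + 2 * μ) * n.factorial * ((n + 1 : ℕ) : ℝ) := by push_cast; ring
      _ ≤ _ := mul_le_mul ih hn (Nat.cast_nonneg _) (genGamma_pos hμ _).le

/-- Majorant for the termwise derivative of the series defining `genExp`. -/
theorem succ_mul_pow_div_genGamma_le {μ : ℝ} (hμ : -1 / 2 < μ) {R : ℝ} (hR : 0 ≤ R) (n : ℕ) :
    ((n : ℝ) + 1) * R ^ n / genGamma μ (n + 1) ≤
      (1 + 2 * μ)⁻¹ * ((2 * R) ^ n / n.factorial) := by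
  have h2 : (n : ℝ) + 1 ≤ 2 ^ n := by exact_mod_cast Nat.lt_two_pow_self (n := n)
  have hpos : 0 < 1 + 2 * μ := by linarith
  have hf : (0 : ℝ) < n.factorial := by exact_mod_cast n.factorial_pos
  calc ((n : ℝ) + 1) * R ^ n / genGamma μ (n + 1)
      ≤ (2 ^ n * R ^ n) / ((1 + 2 * μ) * n.factorial) := by
        gcongr
        exact factorial_mul_le_genGamma_succ hμ n
    _ = _ := by
        rw [mul_pow]
        field_simp

theorem summable_succ_mul_pow_div_genGamma {μ : ℝ} (hμ : -1 / 2 < μ) (x : ℝ) :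
    Summable fun n : ℕ => ((n : ℝ) + 1) * x ^ n / genGamma μ (n + 1) := by
  refine Summable.of_norm_bounded
    ((Real.summable_pow_div_factorial (2 * |x|)).mul_left (1 + 2 * μ)⁻¹) fun n => ?_
  rw [norm_div, norm_mul, norm_pow, Real.norm_of_nonneg (genGamma_pos hμ _).le,
    Real.norm_of_nonneg (by positivity : (0 : ℝ) ≤ n + 1), Real.norm_eq_abs]
  exact succ_mul_pow_div_genGamma_le hμ (abs_nonneg x) n

theorem summable_pow_div_genGamma {μ : ℝ} (hμ : -1 / 2 < μ) (x : ℝ) :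
    Summable fun n : ℕ => x ^ n / genGamma μ n := by
  rw [← summable_nat_add_iff 1]
  refine Summable.of_norm_bounded
    ((summable_succ_mul_pow_div_genGamma hμ |x|).mul_left |x|) fun n => ?_
  have hg := genGamma_pos hμ (n + 1)
  rw [norm_div, norm_pow, Real.norm_of_nonneg hg.le, Real.norm_eq_abs, ← mul_div_assoc]
  gcongr
  have h : 0 ≤ (n : ℝ) * (|x| * |x| ^ n) := by positivity
  rw [pow_succ]
  linarith

theorem hasDerivAt_genExp {μ : ℝ} (hμ : -1 / 2 < μ) (x : ℝ) :
    HasDerivAt (genExp μ) (∑' n : ℕ, ((n : ℝ) + 1) * x ^ n / genGamma μ (n + 1)) x := by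
  have hR : 0 < |x| + 1 := by positivity
  have hu : Summable fun n : ℕ => (n : ℝ) * (|x| + 1) ^ (n - 1) / genGamma μ n := by
    rw [← summable_nat_add_iff 1]
    simpa using summable_succ_mul_pow_div_genGamma hμ (|x| + 1)
  have hbound : ∀ (n : ℕ) (y : ℝ), y ∈ Metric.ball (0 : ℝ) (|x| + 1) →
      ‖(n : ℝ) * y ^ (n - 1) / genGamma μ n‖ ≤
        (n : ℝ) * (|x| + 1) ^ (n - 1) / genGamma μ n := by
    intro n y hy
    have hg := genGamma_pos hμ n
    rw [mem_ball_zero_iff] at hy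
    rw [norm_div, norm_mul, norm_pow, Real.norm_of_nonneg hg.le, Real.norm_natCast]
    gcongr
  have hx : x ∈ Metric.ball (0 : ℝ) (|x| + 1) := by simp
  have h := hasDerivAt_tsum_of_isPreconnected hu Metric.isOpen_ball
    (convex_ball (0 : ℝ) (|x| + 1)).isPreconnected
    (fun n y _ => (hasDerivAt_pow n y).div_const (genGamma μ n)) hbound hx
    (summable_pow_div_genGamma hμ x) hx
  have hs : Summable fun n : ℕ => (n : ℝ) * x ^ (n - 1) / genGamma μ n :=
    Summable.of_norm_bounded hu fun n => hbound n x hx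
  rw [hs.tsum_eq_zero_add] at h
  simp only [Nat.cast_zero, zero_mul, zero_div, zero_add, Nat.cast_add, Nat.cast_one,
    Nat.add_sub_cancel] at h
  exact h

/-- For nonpositive `μ`, the function `genExp μ` satisfies `e' ≥ e - 2 μ / (1 + 2 μ)`. -/
theorem genExp_add_le_deriv {μ : ℝ} (hμ1 : -1 / 2 < μ) (hμ2 : μ ≤ 0) (x : ℝ) :
    genExp μ x + -(2 * μ) / (1 + 2 * μ) ≤ deriv (genExp μ) x := by
  rw [(hasDerivAt_genExp hμ1 x).deriv, genExp,
    ← tsum_ite_eq (0 : ℕ) (fun _ => -(2 * μ) / (1 + 2 * μ)),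
    ← (summable_pow_div_genGamma hμ1 x).tsum_add (hasSum_ite_eq _ _).summable]
  refine Summable.tsum_le_tsum (fun n => ?_)
    ((summable_pow_div_genGamma hμ1 x).add (hasSum_ite_eq _ _).summable)
    (summable_succ_mul_pow_div_genGamma hμ1 x)
  have hg := genGamma_pos hμ1 n
  have hg' := genGamma_pos hμ1 (n + 1)
  have hrec := genGamma_succ hμ1 n
  have hsplit : ((n : ℝ) + 1) * x ^ n / genGamma μ (n + 1) = x ^ n / genGamma μ n +
      (-(if Even n then 2 * μ else 0)) * x ^ n / genGamma μ (n + 1) := by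
    rw [div_add_div _ _ hg.ne' hg'.ne', div_eq_div_iff hg'.ne' (mul_pos hg hg').ne', hrec]
    ring
  rw [hsplit]
  gcongr
  rcases eq_or_ne n 0 with rfl | hn
  · simp [genGamma_one hμ1]
  · rw [if_neg hn]
    split_ifs with he
    · exact div_nonneg (mul_nonneg (by linarith) (he.pow_nonneg x)) hg'.le
    · simp

/-- If -1/2 < μ < 0 then there exists x₀ > 0 with e_μ(x) < 0 for all x < -x₀. -/
theorem genExp_neg (μ : ℝ) (hμ1 : -1 / 2 < μ) (hμ2 : μ < 0) :
    ∃ x₀ : ℝ, 0 < x₀ ∧ ∀ x : ℝ, x < -x₀ → genExp μ x < 0 := by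
  set c : ℝ := -(2 * μ) / (1 + 2 * μ) with hc
  have hcpos : 0 < c := div_pos (by linarith) (by linarith)
  have hderiv : ∀ y, HasDerivAt (fun y => Real.exp (-y) * genExp μ y)
      (Real.exp (-y) * (deriv (genExp μ) y - genExp μ y)) y := fun y => by
    have h := ((hasDerivAt_neg y).exp).mul (hasDerivAt_genExp hμ1 y).differentiableAt.hasDerivAt
    exact h.congr_deriv (by ring)
  have hzero : genExp μ 0 = 1 := by
    rw [genExp, tsum_eq_single 0 fun n hn => by simp [hn]]
    simp [genGamma_zero hμ1]
  refine ⟨1 / c, by positivity, fun x hx => ?_⟩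
  have hx0 : x < 0 := hx.trans (neg_lt_zero.mpr (by positivity))
  obtain ⟨y, hy, hslope⟩ := exists_hasDerivAt_eq_slope _ _ hx0
    (fun y _ => (hderiv y).continuousAt.continuousWithinAt) fun y _ => hderiv y
  have hlow : c ≤ Real.exp (-y) * (deriv (genExp μ) y - genExp μ y) := by
    have h1 : 1 ≤ Real.exp (-y) := Real.one_le_exp (by linarith [hy.2])
    have h2 := genExp_add_le_deriv hμ1 hμ2.le y
    nlinarith
  rw [hslope, le_div_iff₀ (by linarith), hzero] at hlow
  have hcx : c * x < -1 := by
    have h := mul_lt_mul_of_pos_left hx hcpos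
    rwa [mul_neg, mul_one_div_cancel hcpos.ne'] at h
  have hneg : Real.exp (-x) * genExp μ x < 0 := by
    simp only [neg_zero, Real.exp_zero] at hlow
    linarith
  exact (pos_iff_neg_of_mul_neg hneg).mp (Real.exp_pos _)
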